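/- arXiv:1002.0243 — 3 statements merged into one kernel-verified Lean document; each statement's English description precedes it below -/
import Mathlib

section
/- Let h : [a,b] → ℝ be a continuously differentiable function. Then the Banach indicatrix formula holds: ∫_ℝ #{t ∈ [a,b] : h(t) = p} dp = ∫_a^b |h'(t)| dt, where #{·} ∈ [0,∞] denotes the (possibly infinite) number of elements, the left integral is with respect to Lebesgue measure on ℝ, and the function p ↦ #{t ∈ [a,b] : h(t) = p} is Lebesgue measurable. -/
open MeasureTheory

theorem indicator_image_one_le_encard_fiber {α β : Type*} (f : α → β) (S : Set α) (p : β) :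
    (f '' S).indicator (fun _ => (1 : ENNReal)) p ≤ (((S ∩ f ⁻¹' {p}).encard : ℕ∞) : ENNReal) := by
  by_cases hp : p ∈ f '' S
  · obtain ⟨x, hx, rfl⟩ := hp
    rw [Set.indicator_of_mem (Set.mem_image_of_mem f hx)]
    have h1 : (1 : ℕ∞) ≤ (S ∩ f ⁻¹' {f x}).encard :=
      Set.one_le_encard_iff_nonempty.2 ⟨x, hx, rfl⟩
    exact_mod_cast h1
  · simp [Set.indicator_of_notMem hp]

theorem Set.InjOn.encard_fiber_eq_indicator {α β : Type*} {f : α → β} {S : Set α}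
    (hf : S.InjOn f) (p : β) :
    (((S ∩ f ⁻¹' {p}).encard : ℕ∞) : ENNReal) = (f '' S).indicator (fun _ => (1 : ENNReal)) p := by
  refine le_antisymm ?_ (indicator_image_one_le_encard_fiber f S p)
  by_cases hp : p ∈ f '' S
  · rw [Set.indicator_of_mem hp]
    have h1 : (S ∩ f ⁻¹' {p}).encard ≤ 1 := by
      rw [Set.encard_le_one_iff]
      rintro x y ⟨hx, hxp⟩ ⟨hy, hyp⟩
      exact hf hx hy (hxp.trans hyp.symm)
    exact_mod_cast h1
  · have h0 : S ∩ f ⁻¹' {p} = ∅ := by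
      ext x
      simp only [Set.mem_inter_iff, Set.mem_preimage, Set.mem_singleton_iff,
        Set.mem_empty_iff_false, iff_false, not_and]
      exact fun hx hxp => hp ⟨x, hx, hxp⟩
    simp [h0]

theorem encard_iUnion_of_pairwise_disjoint {α ι : Type*} [Countable ι] {s : ι → Set α}
    (hs : Pairwise (Function.onFun Disjoint s)) :
    (((⋃ i, s i).encard : ℕ∞) : ENNReal) = ∑' i, (((s i).encard : ℕ∞) : ENNReal) := by
  let _ : MeasurableSpace α := ⊤
  have hm : ∀ s : Set α, Measure.count s = s.encard := fun s => Measure.count_apply trivial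
  simp only [← hm]
  exact measure_iUnion hs fun _ => trivial

theorem Finset.exists_nat_injOn_floor_mul (F : Finset ℝ) :
    ∃ n : ℕ, Set.InjOn (fun x : ℝ => ⌊(n : ℝ) * x⌋) F := by
  have key : ∀ᶠ n : ℕ in Filter.atTop, ∀ x ∈ F, ∀ y ∈ F, x ≠ y → ⌊(n : ℝ) * x⌋ ≠ ⌊(n : ℝ) * y⌋ := by
    simp only [Filter.eventually_all_finset, Filter.eventually_all]
    intro x _ y _ hxy
    have hd : 0 < |x - y| := abs_pos.2 (sub_ne_zero.2 hxy)
    filter_upwards [tendsto_natCast_atTop_atTop.eventually_ge_atTop (1 / |x - y|)] with n hn heq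
    have h1 : |(n : ℝ) * x - n * y| < 1 := Int.abs_sub_lt_one_of_floor_eq_floor heq
    rw [← mul_sub, abs_mul, Nat.abs_cast] at h1
    rw [div_le_iff₀ hd] at hn
    linarith
  obtain ⟨n, hn⟩ := key.exists
  exact ⟨n, fun x hx y hy hxy => by_contra fun hne => hn x hx y hy hne hxy⟩

theorem encard_eq_iSup_tsum_indicator_image_floor (f : ℝ → ℝ) (S : Set ℝ) (p : ℝ) :
    (((S ∩ f ⁻¹' {p}).encard : ℕ∞) : ENNReal) = ⨆ n : ℕ, ∑' k : ℤ,
      (f '' (S ∩ {x | ⌊(n : ℝ) * x⌋ = k})).indicator (fun _ => (1 : ENNReal)) p := by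
  apply le_antisymm
  · refine ENNReal.le_of_forall_nnreal_lt fun r hr => ?_
    have hF : ∃ F : Finset ℝ, (F : Set ℝ) ⊆ S ∩ f ⁻¹' {p} ∧ (r : ENNReal) ≤ F.card := by
      rcases Set.finite_or_infinite (S ∩ f ⁻¹' {p}) with hfin | hinf
      · refine ⟨hfin.toFinset, by simp, ?_⟩
        rw [hfin.encard_eq_coe_toFinset_card] at hr
        exact hr.le.trans (by simp)
      · obtain ⟨m, hm⟩ := exists_nat_ge r
        obtain ⟨F, hF, hc⟩ := hinf.exists_subset_card_eq m
        exact ⟨F, hF, by rw [hc]; exact_mod_cast hm⟩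
    obtain ⟨F, hFS, hrF⟩ := hF
    obtain ⟨n, hn⟩ := F.exists_nat_injOn_floor_mul
    refine hrF.trans (le_iSup_of_le n ?_)
    refine le_trans ?_ (ENNReal.sum_le_tsum (F.image fun x : ℝ => ⌊(n : ℝ) * x⌋))
    rw [Finset.sum_image hn, Finset.card_eq_sum_ones, Nat.cast_sum]
    refine Finset.sum_le_sum fun x hx => ?_
    have hxS := hFS hx
    have hp : p ∈ f '' (S ∩ {y | ⌊(n : ℝ) * y⌋ = ⌊(n : ℝ) * x⌋}) := ⟨x, ⟨hxS.1, rfl⟩, hxS.2⟩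
    rw [Set.indicator_of_mem hp, Nat.cast_one]
  · refine iSup_le fun n => ?_
    have hU : S ∩ f ⁻¹' {p} = ⋃ k : ℤ, (S ∩ {x | ⌊(n : ℝ) * x⌋ = k}) ∩ f ⁻¹' {p} := by
      ext x
      simp
    rw [hU, encard_iUnion_of_pairwise_disjoint]
    · exact ENNReal.tsum_le_tsum fun k => indicator_image_one_le_encard_fiber f _ p
    · intro i j hij
      refine Set.disjoint_left.2 fun x hx hy => hij ?_
      exact hx.1.2.symm.trans hy.1.2

theorem Continuous.measurable_encard_fiber {f : ℝ → ℝ} (hf : Continuous f) {S : Set ℝ}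
    (hS : S.OrdConnected) :
    Measurable fun p : ℝ => (((S ∩ f ⁻¹' {p}).encard : ℕ∞) : ENNReal) := by
  simp only [encard_eq_iSup_tsum_indicator_image_floor]
  refine Measurable.iSup fun n => Measurable.tsum fun k => measurable_const.indicator ?_
  have hmono : Monotone fun x : ℝ => ⌊(n : ℝ) * x⌋ := fun x y hxy =>
    Int.floor_le_floor (mul_le_mul_of_nonneg_left hxy n.cast_nonneg)
  have hpre : {x : ℝ | ⌊(n : ℝ) * x⌋ = k}.OrdConnected :=
    Set.ordConnected_singleton.preimage_mono (s := {k}) hmono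
  exact ((hS.inter hpre).isPreconnected.image f hf.continuousOn).ordConnected.measurableSet

/-- A set on which the derivative does not vanish splits into countably many measurable pieces on
which the function is injective. -/
theorem exists_partition_injOn_of_hasDerivWithinAt_ne_zero {f f' : ℝ → ℝ} {U : Set ℝ}
    (hf : ∀ x ∈ U, HasDerivWithinAt f (f' x) U x) (hf' : ∀ x ∈ U, f' x ≠ 0) :
    ∃ t : ℕ → Set ℝ, Pairwise (Function.onFun Disjoint t) ∧ (∀ n, MeasurableSet (t n)) ∧
      U ⊆ ⋃ n, t n ∧ ∀ n, Set.InjOn f (U ∩ t n) := by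
  classical
  obtain ⟨t, A, hd, hm, hU, happ, hA⟩ := exists_partition_approximatesLinearOn_of_hasFDerivWithinAt
    f U _ (fun x hx => (hf x hx).hasFDerivWithinAt)
    (fun L => if L = 0 then 1 else ‖L‖₊ / 2) (fun L => by
      split_ifs with hL
      · exact one_ne_zero
      · simpa using hL)
  refine ⟨t, hd, hm, hU, fun n x hx y hy hxy => ?_⟩
  obtain ⟨z, hz, hAz⟩ := hA ⟨x, hx.1⟩ n
  have hne : A n ≠ 0 := by
    rw [hAz]
    intro h0
    have := congrArg (fun L : ℝ →L[ℝ] ℝ => L 1) h0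
    exact hf' z hz (by simpa using this)
  have h1 := happ n x hx y hy
  simp only [if_neg hne, hxy, sub_self, zero_sub, norm_neg] at h1
  have h2 : ‖A n (x - y)‖ = ‖A n‖ * ‖x - y‖ := by
    rw [hAz]
    simp [mul_comm]
  rw [h2] at h1
  have h3 : 0 < ‖A n‖ := norm_pos_iff.2 hne
  push_cast at h1
  have h4 : ‖x - y‖ ≤ 0 := by
    by_contra! hc
    nlinarith [mul_pos h3 hc]
  exact sub_eq_zero.1 (norm_le_zero_iff.1 h4)

/-- The area formula for a real function on a measurable set. -/
theorem lintegral_encard_fiber_eq_lintegral_abs_deriv {f f' : ℝ → ℝ} {S : Set ℝ}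
    (hS : MeasurableSet S) (hf' : Measurable f') (hf : ∀ x ∈ S, HasDerivWithinAt f (f' x) S x) :
    ∫⁻ p : ℝ, (((S ∩ f ⁻¹' {p}).encard : ℕ∞) : ENNReal)
      = ∫⁻ x in S, ENNReal.ofReal |f' x| := by
  have hZm : MeasurableSet (f' ⁻¹' {0}) := hf' (measurableSet_singleton 0)
  set Z := S ∩ f' ⁻¹' {0} with hZ
  set U := S \ f' ⁻¹' {0} with hU
  have hUm : MeasurableSet U := hS.diff hZm
  have hZU : Z ∪ U = S := Set.inter_union_sdiff S _
  have hdisj : Disjoint Z U := Set.disjoint_sdiff_inter.symm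
  have hfU : ∀ x ∈ U, HasDerivWithinAt f (f' x) U x := fun x hx =>
    (hf x hx.1).mono Set.sdiff_subset
  obtain ⟨t, htd, htm, hUt, hinj⟩ :=
    exists_partition_injOn_of_hasDerivWithinAt_ne_zero hfU fun x hx => hx.2
  have hpm : ∀ n, MeasurableSet (U ∩ t n) := fun n => hUm.inter (htm n)
  have hpd : ∀ n, ∀ x ∈ U ∩ t n, HasDerivWithinAt f (f' x) (U ∩ t n) x := fun n x hx =>
    (hfU x hx.1).mono Set.inter_subset_left
  have hpdisj : Pairwise (Function.onFun Disjoint fun n => U ∩ t n) := fun i j hij =>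
    (htd hij).mono Set.inter_subset_right Set.inter_subset_right
  have hUun : ⋃ n, U ∩ t n = U := by
    rw [← Set.inter_iUnion, Set.inter_eq_left.2 hUt]
  have hnull : volume (f '' Z) = 0 := by
    refine addHaar_image_eq_zero_of_det_fderivWithin_eq_zero volume
      (fun x hx => ((hf x hx.1).mono Set.inter_subset_left).hasFDerivWithinAt) fun x hx => ?_
    have h0 : f' x = 0 := hx.2
    simp [h0]
  have hae : ∀ᵐ p : ℝ, (((S ∩ f ⁻¹' {p}).encard : ℕ∞) : ENNReal)
      = ∑' n, (f '' (U ∩ t n)).indicator (fun _ => (1 : ENNReal)) p := by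
    filter_upwards [measure_eq_zero_iff_ae_notMem.1 hnull] with p hp
    have hfib : S ∩ f ⁻¹' {p} = ⋃ n, (U ∩ t n) ∩ f ⁻¹' {p} := by
      rw [← Set.iUnion_inter, hUun, ← hZU, Set.union_inter_distrib_right]
      refine Set.union_eq_right.2 fun x hx => (hp ⟨x, hx.1, hx.2⟩).elim
    rw [hfib, encard_iUnion_of_pairwise_disjoint fun i j hij =>
      (hpdisj hij).mono Set.inter_subset_left Set.inter_subset_left]
    exact tsum_congr fun n => (hinj n).encard_fiber_eq_indicator p
  have him : ∀ n, MeasurableSet (f '' (U ∩ t n)) := fun n =>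
    measurable_image_of_fderivWithin (hpm n) (fun x hx => (hpd n x hx).hasFDerivWithinAt) (hinj n)
  have hZint : ∫⁻ x in Z, ENNReal.ofReal |f' x| = 0 := by
    refine (setLIntegral_congr_fun (g := fun _ => 0) (hS.inter hZm) fun x hx => ?_).trans (by simp)
    have h0 : f' x = 0 := hx.2
    simp [h0]
  rw [lintegral_congr_ae hae,
    lintegral_tsum fun n => (measurable_const.indicator (him n)).aemeasurable,
    ← hZU, lintegral_union hUm hdisj, hZint, zero_add]
  conv_rhs => rw [← hUun, lintegral_iUnion hpm hpdisj]
  refine tsum_congr fun n => ?_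
  rw [lintegral_indicator (him n),
    lintegral_image_eq_lintegral_abs_deriv_mul (hpm n) (hpd n) (hinj n)]
  simp

/-- **The Banach indicatrix formula** (one-dimensional co-area formula).
For a continuously differentiable `h` on `[a,b]`, the function counting the solutions
`t ∈ [a,b]` of `h t = p` is measurable, and its Lebesgue integral over `p ∈ ℝ` equals
`∫_a^b |h'(t)| dt`. -/
theorem stmt3 (a b : ℝ) (h : ℝ → ℝ) (hh : ContDiff ℝ 1 h) :
    Measurable (fun p : ℝ => (({t ∈ Set.Icc a b | h t = p}.encard : ℕ∞) : ENNReal)) ∧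
    ∫⁻ p : ℝ, (({t ∈ Set.Icc a b | h t = p}.encard : ℕ∞) : ENNReal)
      = ∫⁻ t in Set.Icc a b, ENNReal.ofReal |deriv h t| :=
  ⟨hh.continuous.measurable_encard_fiber Set.ordConnected_Icc,
    lintegral_encard_fiber_eq_lintegral_abs_deriv measurableSet_Icc (measurable_deriv h)
      fun x _ => (hh.differentiable one_ne_zero x).hasDerivAt.hasDerivWithinAt⟩
end

section
/- Let V ⊆ ℍ be the 3-dimensional real subspace of purely imaginary quaternions. For every ℝ-linear isometry A : V → V with determinant 1, there exists a unit quaternion q such that A(x) = q·x·q̄ for every x ∈ V; that is, the homomorphism q ↦ (x ↦ q x q̄) from the unit quaternions is surjective onto the rotation group of V. -/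
open Quaternion

/-- The 3-dimensional real subspace `V ⊆ ℍ` of purely imaginary quaternions. -/
def imQuat : Submodule ℝ (Quaternion ℝ) where
  carrier := {x : ℍ[ℝ] | x.re = 0}
  add_mem' := by
    intro a b ha hb
    simp only [Set.mem_setOf_eq] at *
    simp [ha, hb]
  zero_mem' := by simp
  smul_mem' := by
    intro r x hx
    simp only [Set.mem_setOf_eq] at *
    simp [hx]

/-- The coordinates `(imI, imJ, imK)` identify the purely imaginary quaternions with `ℝ³`. -/
def imQuatEquivFun : imQuat ≃ₗ[ℝ] (Fin 3 → ℝ) where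
  toFun x := ![(x : ℍ[ℝ]).imI, (x : ℍ[ℝ]).imJ, (x : ℍ[ℝ]).imK]
  invFun c := ⟨⟨0, c 0, c 1, c 2⟩, rfl⟩
  map_add' x y := by ext n; fin_cases n <;> simp
  map_smul' r x := by ext n; fin_cases n <;> simp
  left_inv x := by
    have hx : (x : ℍ[ℝ]).re = 0 := x.2
    apply Subtype.ext
    apply Quaternion.ext <;> simp [hx]
  right_inv c := by ext n; fin_cases n <;> rfl

/-- The basis `i, j, k` of the purely imaginary quaternions. -/
noncomputable def imQuatBasis : Module.Basis (Fin 3) ℝ imQuat :=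
  Module.Basis.ofEquivFun imQuatEquivFun

/-- The quaternion unit `i`. -/
noncomputable def Quaternion.unitI : ℍ[ℝ] := ⟨0, 1, 0, 0⟩

/-- The quaternion unit `j`. -/
noncomputable def Quaternion.unitJ : ℍ[ℝ] := ⟨0, 0, 1, 0⟩

/-- The quaternion unit `k`. -/
noncomputable def Quaternion.unitK : ℍ[ℝ] := ⟨0, 0, 0, 1⟩

namespace Quaternion

@[simp] theorem re_unitI : unitI.re = 0 := rfl
@[simp] theorem imI_unitI : unitI.imI = 1 := rfl
@[simp] theorem imJ_unitI : unitI.imJ = 0 := rfl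
@[simp] theorem imK_unitI : unitI.imK = 0 := rfl

@[simp] theorem re_unitJ : unitJ.re = 0 := rfl
@[simp] theorem imI_unitJ : unitJ.imI = 0 := rfl
@[simp] theorem imJ_unitJ : unitJ.imJ = 1 := rfl
@[simp] theorem imK_unitJ : unitJ.imK = 0 := rfl

@[simp] theorem re_unitK : unitK.re = 0 := rfl
@[simp] theorem imI_unitK : unitK.imI = 0 := rfl
@[simp] theorem imJ_unitK : unitK.imJ = 0 := rfl
@[simp] theorem imK_unitK : unitK.imK = 1 := rfl

end Quaternion

theorem coe_imQuatBasis_zero : (imQuatBasis 0 : ℍ[ℝ]) = Quaternion.unitI := by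
  simp [imQuatBasis, imQuatEquivFun]
  rfl

theorem coe_imQuatBasis_one : (imQuatBasis 1 : ℍ[ℝ]) = Quaternion.unitJ := by
  simp [imQuatBasis, imQuatEquivFun]
  rfl

theorem coe_imQuatBasis_two : (imQuatBasis 2 : ℍ[ℝ]) = Quaternion.unitK := by
  simp [imQuatBasis, imQuatEquivFun]
  rfl

theorem det_eq_of_imQuatBasis (f : imQuat →ₗ[ℝ] imQuat) (u v w : ℍ[ℝ])
    (hu : (f (imQuatBasis 0) : ℍ[ℝ]) = u) (hv : (f (imQuatBasis 1) : ℍ[ℝ]) = v)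
    (hw : (f (imQuatBasis 2) : ℍ[ℝ]) = w) :
    LinearMap.det f = (u.imJ * v.imK - u.imK * v.imJ) * w.imI +
      (u.imK * v.imI - u.imI * v.imK) * w.imJ + (u.imI * v.imJ - u.imJ * v.imI) * w.imK := by
  have hr (x : imQuat) : imQuatBasis.repr x = imQuatEquivFun x :=
    congrArg _ rfl
  rw [← LinearMap.det_toMatrix imQuatBasis, Matrix.det_fin_three]
  simp only [LinearMap.toMatrix_apply, hr, imQuatEquivFun, LinearEquiv.coe_mk, LinearMap.coe_mk,
    AddHom.coe_mk, hu, hv, hw]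
  simp
  ring

/-- In a positively oriented orthonormal triple of imaginary quaternions, the third is the product
of the first two. -/
theorem Quaternion.mul_eq_of_orthonormal {u v w : ℍ[ℝ]} (hu : u.re = 0) (hv : v.re = 0)
    (hw : w.re = 0) (huu : inner ℝ u u = 1) (hvv : inner ℝ v v = 1) (hww : inner ℝ w w = 1)
    (huv : inner ℝ u v = 0)
    (hdet : (u.imJ * v.imK - u.imK * v.imJ) * w.imI +
      (u.imK * v.imI - u.imI * v.imK) * w.imJ + (u.imI * v.imJ - u.imJ * v.imI) * w.imK = 1) :
    u * v = w := by
  simp [Quaternion.inner_def, hu, hv, hw, -inner_self_eq_norm_sq_to_K] at huu hvv hww huv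
  have h : (u.imJ * v.imK - u.imK * v.imJ - w.imI) ^ 2 +
      (u.imK * v.imI - u.imI * v.imK - w.imJ) ^ 2 +
      (u.imI * v.imJ - u.imJ * v.imI - w.imK) ^ 2 = 0 := by
    linear_combination hww - 2 * hdet + hvv +
      (v.imI * v.imI + v.imJ * v.imJ + v.imK * v.imK) * huu -
      (u.imI * v.imI + u.imJ * v.imJ + u.imK * v.imK) * huv
  apply Quaternion.ext
  · simp [hu, hv, hw]; linarith
  all_goals
    simp [hu, hv]
    nlinarith [h, sq_nonneg (u.imJ * v.imK - u.imK * v.imJ - w.imI),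
      sq_nonneg (u.imK * v.imI - u.imI * v.imK - w.imJ),
      sq_nonneg (u.imI * v.imJ - u.imJ * v.imI - w.imK)]

theorem Quaternion.mul_self_eq_neg_one {u : ℍ[ℝ]} (hu : u.re = 0) (huu : inner ℝ u u = 1) :
    u * u = -1 := by
  simp [Quaternion.inner_def, hu, -inner_self_eq_norm_sq_to_K] at huu
  apply Quaternion.ext <;> simp [hu] <;> linarith

/-- The averaging operator attached to `u, v, u * v`: its values intertwine `u, v` with `i, j`. -/
noncomputable def Quaternion.intertwiner (u v p : ℍ[ℝ]) : ℍ[ℝ] :=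
  p - u * p * Quaternion.unitI - v * p * Quaternion.unitJ - u * v * p * Quaternion.unitK

theorem Quaternion.mul_intertwiner_left {u v : ℍ[ℝ]} (huu : u * u = -1) (p : ℍ[ℝ]) :
    u * intertwiner u v p = intertwiner u v p * unitI := by
  have h1 : unitI * unitI = -1 := by apply Quaternion.ext <;> simp
  have h2 : unitJ * unitI = -unitK := by apply Quaternion.ext <;> simp
  have h3 : unitK * unitI = unitJ := by apply Quaternion.ext <;> simp
  have hu (x : ℍ[ℝ]) : u * (u * x) = -x := by rw [← mul_assoc, huu, neg_one_mul]
  simp only [intertwiner, mul_sub, sub_mul, mul_assoc, h1, h2, h3, hu, mul_neg, mul_one]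
  abel

theorem Quaternion.mul_intertwiner_right {u v : ℍ[ℝ]} (hvv : v * v = -1) (hvu : v * u = -(u * v))
    (p : ℍ[ℝ]) : v * intertwiner u v p = intertwiner u v p * unitJ := by
  have h1 : unitI * unitJ = unitK := by apply Quaternion.ext <;> simp
  have h2 : unitJ * unitJ = -1 := by apply Quaternion.ext <;> simp
  have h3 : unitK * unitJ = -unitI := by apply Quaternion.ext <;> simp
  have hv (x : ℍ[ℝ]) : v * (v * x) = -x := by rw [← mul_assoc, hvv, neg_one_mul]
  have hu (x : ℍ[ℝ]) : v * (u * x) = -(u * (v * x)) := by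
    rw [← mul_assoc, hvu, neg_mul, mul_assoc]
  simp only [intertwiner, mul_sub, sub_mul, mul_assoc, h1, h2, h3, hv, hu, mul_neg, mul_one]
  abel

/-- The averaging operator has trace `4`, so it does not vanish identically. -/
theorem Quaternion.exists_intertwiner_ne_zero {u v : ℍ[ℝ]} (hu : u.re = 0) (hv : v.re = 0)
    (huv : (u * v).re = 0) : ∃ p, intertwiner u v p ≠ 0 := by
  by_contra! h
  have h0 := congrArg (fun x : ℍ[ℝ] => x.re) (h 1)
  have h1 := congrArg (fun x : ℍ[ℝ] => x.imI) (h unitI)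
  have h2 := congrArg (fun x : ℍ[ℝ] => x.imJ) (h unitJ)
  have h3 := congrArg (fun x : ℍ[ℝ] => x.imK) (h unitK)
  simp only [intertwiner] at h0 h1 h2 h3
  generalize u * v = w at *
  simp [hu, hv, huv] at h0 h1 h2 h3
  linarith

/-- Two anticommuting square roots of `-1` with imaginary product are simultaneously conjugate to
`i` and `j`. -/
theorem Quaternion.exists_norm_eq_one_and_mul_eq {u v : ℍ[ℝ]} (hu : u.re = 0) (hv : v.re = 0)
    (huv : (u * v).re = 0) (huu : u * u = -1) (hvv : v * v = -1) (hvu : v * u = -(u * v)) :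
    ∃ q : ℍ[ℝ], ‖q‖ = 1 ∧ u * q = q * unitI ∧ v * q = q * unitJ := by
  obtain ⟨p, hp⟩ := exists_intertwiner_ne_zero hu hv huv
  refine ⟨‖intertwiner u v p‖⁻¹ • intertwiner u v p, ?_, ?_, ?_⟩
  · rw [norm_smul, norm_inv, norm_norm, inv_mul_cancel₀ (norm_ne_zero_iff.mpr hp)]
  · rw [mul_smul_comm, smul_mul_assoc, mul_intertwiner_left huu]
  · rw [mul_smul_comm, smul_mul_assoc, mul_intertwiner_right hvv hvu]

/-- **Every rotation of the imaginary quaternions is conjugation by a unit quaternion.**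
If `A` is a surjective `ℝ`-linear isometry of the space `V` of purely imaginary
quaternions with determinant `1`, then there is a unit quaternion `q` with
`A x = q·x·q̄` for all `x ∈ V`. -/
theorem stmt6 (A : imQuat →ₗᵢ[ℝ] imQuat) (hsurj : Function.Surjective A)
    (hdet : LinearMap.det A.toLinearMap = 1) :
    ∃ q : ℍ[ℝ], ‖q‖ = 1 ∧
      ∀ x : imQuat, (A x : ℍ[ℝ]) = q * (x : ℍ[ℝ]) * star q := by
  have hA (x y : imQuat) : inner ℝ (A x : ℍ[ℝ]) (A y : ℍ[ℝ]) = inner ℝ (x : ℍ[ℝ]) (y : ℍ[ℝ]) :=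
    A.inner_map_map x y
  obtain ⟨u, hu⟩ : ∃ u, (A (imQuatBasis 0) : ℍ[ℝ]) = u := ⟨_, rfl⟩
  obtain ⟨v, hv⟩ : ∃ v, (A (imQuatBasis 1) : ℍ[ℝ]) = v := ⟨_, rfl⟩
  obtain ⟨w, hw⟩ : ∃ w, (A (imQuatBasis 2) : ℍ[ℝ]) = w := ⟨_, rfl⟩
  have hu0 : u.re = 0 := hu ▸ (A (imQuatBasis 0)).2
  have hv0 : v.re = 0 := hv ▸ (A (imQuatBasis 1)).2
  have hw0 : w.re = 0 := hw ▸ (A (imQuatBasis 2)).2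
  have huu : inner ℝ u u = 1 := by
    rw [← hu, hA, coe_imQuatBasis_zero]; simp [Quaternion.inner_def, -inner_self_eq_norm_sq_to_K]
  have hvv : inner ℝ v v = 1 := by
    rw [← hv, hA, coe_imQuatBasis_one]; simp [Quaternion.inner_def, -inner_self_eq_norm_sq_to_K]
  have hww : inner ℝ w w = 1 := by
    rw [← hw, hA, coe_imQuatBasis_two]; simp [Quaternion.inner_def, -inner_self_eq_norm_sq_to_K]
  have huv : inner ℝ u v = 0 := by
    rw [← hu, ← hv, hA, coe_imQuatBasis_zero, coe_imQuatBasis_one]; simp [Quaternion.inner_def]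
  rw [det_eq_of_imQuatBasis A.toLinearMap u v w hu hv hw] at hdet
  have hmul : u * v = w := Quaternion.mul_eq_of_orthonormal hu0 hv0 hw0 huu hvv hww huv hdet
  have hvu : v * u = -(u * v) := by
    have hs : star (u * v) = -(u * v) := by
      rw [hmul]; apply Quaternion.ext <;> simp [hw0]
    have hus : star u = -u := by apply Quaternion.ext <;> simp [hu0]
    have hvs : star v = -v := by apply Quaternion.ext <;> simp [hv0]
    rwa [star_mul, hus, hvs, neg_mul_neg] at hs
  obtain ⟨q, hq, hqu, hqv⟩ := Quaternion.exists_norm_eq_one_and_mul_eq hu0 hv0 (hmul ▸ hw0)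
    (Quaternion.mul_self_eq_neg_one hu0 huu) (Quaternion.mul_self_eq_neg_one hv0 hvv) hvu
  have hqw : w * q = q * Quaternion.unitK := by
    have hij : Quaternion.unitI * Quaternion.unitJ = Quaternion.unitK := by apply Quaternion.ext <;> simp
    rw [← hmul, mul_assoc, hqv, ← mul_assoc, hqu, mul_assoc, hij]
  have hqq : q * star q = 1 := by
    rw [Quaternion.self_mul_star, Quaternion.normSq_eq_norm_mul_self, hq]; simp
  refine ⟨q, hq, fun x => ?_⟩
  suffices h : (A x : ℍ[ℝ]) * q = q * x by
    rw [← h, mul_assoc, hqq, mul_one]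
  have hlin : (LinearMap.mulRight ℝ q) ∘ₗ imQuat.subtype ∘ₗ A.toLinearMap =
      (LinearMap.mulLeft ℝ q) ∘ₗ imQuat.subtype := by
    refine imQuatBasis.ext fun n => ?_
    fin_cases n
    · simpa [hu, coe_imQuatBasis_zero] using hqu
    · simpa [hv, coe_imQuatBasis_one] using hqv
    · simpa [hw, coe_imQuatBasis_two] using hqw
  exact LinearMap.congr_fun hlin x
end

section
/- For every unit quaternion q, the quaternion π(q) := q·i·q̄ is purely imaginary and has norm 1. Moreover: (a) for every purely imaginary quaternion p with ‖p‖ = 1 there exists a unit quaternion q with q·i·q̄ = p (π is surjective onto the unit sphere of imaginary quaternions); and (b) for unit quaternions q, q' one has q·i·q̄ = q'·i·q̄' if and only if q' = q·(cos θ + i·sin θ) for some θ ∈ ℝ (the fibers of π are the orbits of the circle action by right multiplication by cos θ + i sin θ). -/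
open Quaternion

/-- The quaternion unit `i`. -/
def qI : ℍ[ℝ] := ⟨0, 1, 0, 0⟩

lemma star_mul_self_of_norm_eq_one {q : ℍ[ℝ]} (hq : ‖q‖ = 1) : star q * q = 1 := by
  rw [Quaternion.star_mul_self, Quaternion.normSq_eq_norm_mul_self, hq]
  simp

lemma self_mul_star_of_norm_eq_one {q : ℍ[ℝ]} (hq : ‖q‖ = 1) : q * star q = 1 := by
  rw [Quaternion.self_mul_star, Quaternion.normSq_eq_norm_mul_self, hq]
  simp

lemma norm_eq_one_iff_sum_sq (q : ℍ[ℝ]) :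
    ‖q‖ = 1 ↔ q.re ^ 2 + q.imI ^ 2 + q.imJ ^ 2 + q.imK ^ 2 = 1 := by
  rw [← Quaternion.normSq_def', Quaternion.normSq_eq_norm_mul_self, ← sq,
    pow_eq_one_iff_of_nonneg (norm_nonneg q) two_ne_zero]

@[simp] lemma re_qI : qI.re = 0 := rfl

@[simp] lemma imI_qI : qI.imI = 1 := rfl

@[simp] lemma imJ_qI : qI.imJ = 0 := rfl

@[simp] lemma imK_qI : qI.imK = 0 := rfl

lemma exists_quaternion_of_components (a b c d : ℝ) :
    ∃ q : ℍ[ℝ], q.re = a ∧ q.imI = b ∧ q.imJ = c ∧ q.imK = d :=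
  ⟨⟨a, b, c, d⟩, rfl, rfl, rfl, rfl⟩

lemma norm_qI : ‖qI‖ = 1 := by
  rw [norm_eq_one_iff_sum_sq]
  simp

lemma re_mul_qI_mul_star (q : ℍ[ℝ]) : (q * qI * star q).re = 0 := by
  simp
  ring

lemma exists_mul_qI_mul_star_eq {p : ℍ[ℝ]} (hre : p.re = 0) (hp : ‖p‖ = 1) :
    ∃ q : ℍ[ℝ], ‖q‖ = 1 ∧ q * qI * star q = p := by
  rw [norm_eq_one_iff_sum_sq, hre] at hp
  by_cases hb : p.imI = -1
  · have hJ : p.imJ = 0 := by nlinarith [sq_nonneg p.imJ, sq_nonneg p.imK]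
    have hK : p.imK = 0 := by nlinarith [sq_nonneg p.imJ, sq_nonneg p.imK]
    obtain ⟨q, h₀, h₁, h₂, h₃⟩ := exists_quaternion_of_components 0 0 1 0
    refine ⟨q, ?_, ?_⟩
    · rw [norm_eq_one_iff_sum_sq, h₀, h₁, h₂, h₃]
      norm_num
    · ext <;> simp [h₀, h₁, h₂, h₃, hre, hb, hJ, hK]
  · have hpos : 0 < 2 + 2 * p.imI := by
      have h₁ : -1 ≤ p.imI := by nlinarith [sq_nonneg p.imJ, sq_nonneg p.imK]
      have h₂ : -1 < p.imI := lt_of_le_of_ne h₁ (Ne.symm hb)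
      linarith
    obtain ⟨s, hs⟩ : ∃ s : ℝ, s ^ 2 * (2 + 2 * p.imI) = 1 :=
      ⟨(√(2 + 2 * p.imI))⁻¹, by rw [inv_pow, Real.sq_sqrt hpos.le, inv_mul_cancel₀ hpos.ne']⟩
    obtain ⟨q, h₀, h₁, h₂, h₃⟩ :=
      exists_quaternion_of_components 0 (s * (1 + p.imI)) (s * p.imJ) (s * p.imK)
    refine ⟨q, ?_, ?_⟩
    · rw [norm_eq_one_iff_sum_sq, h₀, h₁, h₂, h₃]
      linear_combination hs + s ^ 2 * hp
    · rw [Quaternion.ext_iff]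
      simp only [Quaternion.re_mul, Quaternion.imI_mul, Quaternion.imJ_mul, Quaternion.imK_mul,
        Quaternion.re_star, Quaternion.imI_star, Quaternion.imJ_star, Quaternion.imK_star,
        re_qI, imI_qI, imJ_qI, imK_qI, h₀, h₁, h₂, h₃, hre]
      refine ⟨by ring, ?_, ?_, ?_⟩
      · linear_combination p.imI * hs - s ^ 2 * hp
      · linear_combination p.imJ * hs
      · linear_combination p.imK * hs

lemma exists_eq_cos_add_sin_smul_qI {u : ℍ[ℝ]} (hu : ‖u‖ = 1) (hcomm : u * qI = qI * u) :
    ∃ θ : ℝ, u = (Real.cos θ : ℍ[ℝ]) + Real.sin θ • qI := by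
  have hJ : u.imJ = 0 := by
    have := congrArg QuaternionAlgebra.imK hcomm
    simp at this
    linarith
  have hK : u.imK = 0 := by
    have := congrArg QuaternionAlgebra.imJ hcomm
    simp at this
    linarith
  rw [norm_eq_one_iff_sum_sq, hJ, hK] at hu
  have hz : ‖(⟨u.re, u.imI⟩ : ℂ)‖ = 1 := by
    rw [← pow_eq_one_iff_of_nonneg (norm_nonneg _) two_ne_zero,
      Complex.sq_norm, Complex.normSq_mk]
    linarith
  obtain ⟨θ, hθ⟩ := (Complex.norm_eq_one_iff _).1 hz
  have hcos : Real.cos θ = u.re := by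
    rw [← Complex.exp_ofReal_mul_I_re, hθ]
  have hsin : Real.sin θ = u.imI := by
    rw [← Complex.exp_ofReal_mul_I_im, hθ]
  refine ⟨θ, ?_⟩
  rw [hcos, hsin]
  ext <;> simp [hJ, hK]

lemma cos_add_sin_smul_qI_mul_qI_mul_star (θ : ℝ) :
    ((Real.cos θ : ℍ[ℝ]) + Real.sin θ • qI) * qI *
      star ((Real.cos θ : ℍ[ℝ]) + Real.sin θ • qI) = qI := by
  have h := Real.sin_sq_add_cos_sq θ
  rw [Quaternion.ext_iff]
  refine ⟨?_, ?_, ?_, ?_⟩ <;> simp <;>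
    linarith

/-- **The Hopf fibration `π(q) = q·i·q̄`.**
For every unit quaternion `q`, `π(q)` is purely imaginary of norm `1`; `π` is surjective
onto the unit sphere of imaginary quaternions; and two unit quaternions have the same
image iff they differ by right multiplication by some `cos θ + i sin θ`. -/
theorem stmt7 :
    (∀ q : ℍ[ℝ], ‖q‖ = 1 → (q * qI * star q).re = 0 ∧ ‖q * qI * star q‖ = 1) ∧
    (∀ p : ℍ[ℝ], p.re = 0 → ‖p‖ = 1 →
      ∃ q : ℍ[ℝ], ‖q‖ = 1 ∧ q * qI * star q = p) ∧
    (∀ q q' : ℍ[ℝ], ‖q‖ = 1 → ‖q'‖ = 1 →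
      (q * qI * star q = q' * qI * star q' ↔
        ∃ θ : ℝ, q' = q * ((Real.cos θ : ℍ[ℝ]) + Real.sin θ • qI))) := by
  refine ⟨fun q hq ↦ ⟨re_mul_qI_mul_star q, ?_⟩, fun p ↦ exists_mul_qI_mul_star_eq,
    fun q q' hq hq' ↦ ⟨fun h ↦ ?_, ?_⟩⟩
  · rw [norm_mul, norm_mul, norm_star, hq, norm_qI]
    norm_num
  · have hu : ‖star q * q'‖ = 1 := by rw [norm_mul, norm_star, hq, hq', one_mul]
    have hcomm : star q * q' * qI = qI * (star q * q') := by
      calc star q * q' * qI = star q * (q' * qI * star q') * q' := by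
            simp only [mul_assoc, star_mul_self_of_norm_eq_one hq', mul_one]
        _ = (star q * q) * qI * (star q * q') := by rw [← h]; simp only [mul_assoc]
        _ = qI * (star q * q') := by rw [star_mul_self_of_norm_eq_one hq, one_mul]
    obtain ⟨θ, hθ⟩ := exists_eq_cos_add_sin_smul_qI hu hcomm
    exact ⟨θ, by rw [← hθ, ← mul_assoc, self_mul_star_of_norm_eq_one hq, one_mul]⟩
  · rintro ⟨θ, rfl⟩
    have h := cos_add_sin_smul_qI_mul_qI_mul_star θ
    generalize (Real.cos θ : ℍ[ℝ]) + Real.sin θ • qI = w at h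
    calc q * qI * star q = q * (w * qI * star w) * star q := by rw [h]
      _ = q * w * qI * star (q * w) := by simp only [star_mul, mul_assoc]
end
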